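/- For any constants α, β ≥ 0 not both zero and any continuous function f on [0,1], lim_{n→∞} (1/n) Σ_{r ≤ n} f((α p_r + β r)/(α p_n + β n)) = ∫_0^1 f(x) dx. -/

import Mathlib

open Filter Real

/-- `p n` is the n-th prime, 1-indexed: `p 1 = 2`. -/
noncomputable def p (n : ℕ) : ℕ := Nat.nth Nat.Prime (n - 1)

/-- Fejer kernel -/
noncomputable def fejK (u : ℝ) : ℝ := sinc (u / 2) ^ 2

lemma fejK_cont : Continuous fejK := by
  unfold fejK; fun_prop

lemma fejK_nonneg (u : ℝ) : 0 ≤ fejK u := sq_nonneg _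

lemma fejK_eq {u : ℝ} (hu : u ≠ 0) : fejK u = 2 * (1 - cos u) / u ^ 2 := by
  unfold fejK
  rw [sinc_of_ne_zero (by positivity)]
  have h : cos u = 1 - 2 * sin (u/2) ^ 2 := by
    have := cos_sq' (u/2)
    have h2 := cos_two_mul (u/2)
    rw [show 2 * (u/2) = u by ring] at h2
    rw [h2, this]; ring
  rw [h]; field_simp; ring

lemma fejK_le (u : ℝ) : fejK u ≤ 5 * (1 + u ^ 2)⁻¹ := by
  have h1 : fejK u ≤ 1 := by
    unfold fejK
    have := abs_sinc_le_one (u/2)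
    nlinarith [sq_abs (sinc (u/2)), abs_nonneg (sinc (u/2))]
  rw [← div_eq_mul_inv, le_div_iff₀ (by positivity)]
  by_cases hu : u = 0
  · subst hu; linarith
  have h2 : fejK u * u ^ 2 ≤ 4 := by
    rw [fejK_eq hu, div_mul_cancel₀ _ (by positivity)]
    linarith [neg_one_le_cos u]
  linarith

lemma fejK_integrable : MeasureTheory.Integrable fejK := by
  refine MeasureTheory.Integrable.mono' (integrable_inv_one_add_sq.const_mul 5)
    fejK_cont.aestronglyMeasurable (.of_forall fun u => ?_)
  rw [norm_of_nonneg (fejK_nonneg u)]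
  exact fejK_le u

lemma fejK_integral_pos : 0 < ∫ u, fejK u := by
  refine MeasureTheory.integral_pos_of_integrable_nonneg_nonzero (x := 0) fejK_cont fejK_integrable
    (fun u => fejK_nonneg u) ?_
  simp [fejK]

lemma fejK_fourier_real {L : ℝ} (hL : 0 < L) (u : ℝ) :
    ∫ y in (0:ℝ)..L, 2 * (1 - y / L) * cos (u * y) = L * fejK (L * u) := by
  by_cases hu : u = 0
  · subst hu
    have : ∀ y ∈ Set.uIcc 0 L, HasDerivAt (fun y => 2 * y - y ^ 2 / L) (2 * (1 - y / L) * cos (0 * y)) y := by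
      intro y _
      have := ((hasDerivAt_id y).const_mul 2).sub (((hasDerivAt_id y).pow 2).div_const L)
      refine HasDerivAt.congr_deriv this ?_
      simp; ring
    rw [intervalIntegral.integral_eq_sub_of_hasDerivAt this
      (Continuous.intervalIntegrable (by fun_prop) _ _)]
    simp [fejK]; field_simp; ring
  have : ∀ y ∈ Set.uIcc 0 L, HasDerivAt
      (fun y => 2 * ((1 - y / L) * (sin (u * y) / u) - cos (u * y) / (L * u ^ 2)))
      (2 * (1 - y / L) * cos (u * y)) y := by
    intro y _
    have hm : HasDerivAt (fun y => u * y) u y := by simpa using (hasDerivAt_id y).const_mul u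
    have := (((((hasDerivAt_id y).div_const L).const_sub 1).mul (hm.sin.div_const u)).sub
      (hm.cos.div_const (L * u ^ 2))).const_mul 2
    refine HasDerivAt.congr_deriv this ?_
    simp; field_simp; ring
  rw [intervalIntegral.integral_eq_sub_of_hasDerivAt this
      (Continuous.intervalIntegrable (by fun_prop) _ _), fejK_eq (by positivity)]
  simp; field_simp; ring_nf

section tauber
open MeasureTheory Complex

lemma taub_swap {φ : ℝ → ℝ} (hm : Measurable φ) {C : ℝ} (hC : ∀ t, |φ t| ≤ C)
    {H : ℂ → ℂ}
    (hH : ∀ s : ℂ, 0 < s.re → ∫ t in Set.Ioi (0:ℝ), (φ t : ℂ) * cexp (-s * t) = H s)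
    {L : ℝ} (hL : 0 < L) {ε : ℝ} (hε : 0 < ε) (x : ℝ) :
    ∫ t in Set.Ioi (0:ℝ), φ t * Real.exp (-ε * t) * (L * fejK (L * (x - t))) =
      (∫ y in (0:ℝ)..L, (2 * (1 - y / L) : ℂ) * cexp (I * x * y) * H (ε + I * y)).re := by
  have hC0 : 0 ≤ C := (abs_nonneg _).trans (hC 0)
  set F : ℝ → ℝ → ℂ := fun t y => (φ t : ℂ) * Real.exp (-ε * t) * ((2 * (1 - y / L) : ℂ) *
    cexp (I * (x - t) * y)) with hF
  have hexp : Integrable (fun t : ℝ => Real.exp (-ε * t)) (volume.restrict (Set.Ioi 0)) := by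
    exact integrableOn_exp_mul_Ioi (by linarith) 0
  have hint : Integrable (Function.uncurry F)
      ((volume.restrict (Set.Ioi (0:ℝ))).prod (volume.restrict (Set.Ioc 0 L))) := by
    have h1 : Integrable (fun y : ℝ => (1:ℝ)) (volume.restrict (Set.Ioc 0 L)) := by
      exact integrable_const _
    have h2 := (hexp.mul_prod h1).const_mul (2 * C)
    refine h2.mono' ?_ ?_
    · apply Measurable.aestronglyMeasurable
      simp only [hF, Function.uncurry_def]
      fun_prop
    · have : ∀ᵐ z ∂((volume.restrict (Set.Ioi (0:ℝ))).prod (volume.restrict (Set.Ioc 0 L))),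
          z ∈ Set.Ioi (0:ℝ) ×ˢ Set.Ioc 0 L := by
        rw [Measure.prod_restrict]
        exact ae_restrict_mem (measurableSet_Ioi.prod measurableSet_Ioc)
      filter_upwards [this] with z hz
      obtain ⟨t, y⟩ := z
      obtain ⟨ht, hy⟩ := hz
      simp only [Set.mem_Ioi, Set.mem_Ioc] at ht hy
      simp only [hF, Function.uncurry_apply_pair, mul_one]
      have e1 : ‖cexp (I * (x - t) * y)‖ = 1 := by
        rw [show I * (x - t) * y = (((x - t) * y : ℝ) : ℂ) * I by push_cast; ring,
          norm_exp_ofReal_mul_I]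
      have e2 : ‖(2 * (1 - y / L) : ℂ)‖ ≤ 2 := by
        rw [show (2 * (1 - y / L) : ℂ) = ((2 * (1 - y / L) : ℝ) : ℂ) by push_cast; ring, norm_real,
          Real.norm_eq_abs, abs_le]
        have : y / L ≤ 1 := by rw [div_le_one hL]; exact hy.2
        have : 0 ≤ y / L := by have := hy.1.le; positivity
        constructor <;> linarith
      rw [norm_mul, norm_mul, norm_mul, e1, mul_one, norm_real, norm_real, Real.norm_eq_abs,
        Real.norm_eq_abs, abs_of_pos (Real.exp_pos _)]
      have := hC t
      have := Real.exp_pos (-ε * t)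
      calc |φ t| * Real.exp (-ε * t) * _ ≤ C * Real.exp (-ε * t) * 2 := by gcongr
        _ = _ := by ring
  have hsw := integral_integral_swap hint
  have hl : ∀ t, ∫ y in Set.Ioc 0 L, F t y = (φ t : ℂ) * Real.exp (-ε * t) *
      ∫ y in (0:ℝ)..L, (2 * (1 - y / L) : ℂ) * cexp (I * (x - t) * y) := by
    intro t
    rw [intervalIntegral.integral_of_le hL.le, integral_const_mul]
  have hre : ∀ u : ℝ, (∫ y in (0:ℝ)..L, (2 * (1 - y / L) : ℂ) * cexp (I * u * y)).re
      = L * fejK (L * u) := by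
    intro u
    rw [← fejK_fourier_real hL u]
    have hi : IntervalIntegrable (fun y : ℝ => (2 * (1 - y / L) : ℂ) * cexp (I * u * y)) volume 0 L :=
      Continuous.intervalIntegrable (by fun_prop) _ _
    have := intervalIntegral.intervalIntegral_re (𝕜 := ℂ) hi
    simp only [RCLike.re_eq_complex_re] at this
    rw [← this]
    congr 1
    ext y
    rw [show I * u * y = ((u * y : ℝ) : ℂ) * I by push_cast; ring,
      show (2 * (1 - y / L) : ℂ) = ((2 * (1 - y / L) : ℝ) : ℂ) by push_cast; ring,
      re_ofReal_mul, exp_ofReal_mul_I_re]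
  have hr : ∀ y : ℝ, ∫ t in Set.Ioi (0:ℝ), F t y =
      (2 * (1 - y / L) : ℂ) * cexp (I * x * y) * H (ε + I * y) := by
    intro y
    rw [← hH (ε + I * y) (by simp [hε]), ← integral_const_mul]
    congr 1
    ext t
    simp only [hF]
    rw [show (-(ε + I * y) * t : ℂ) = ((-ε * t : ℝ) : ℂ) + (-I * y * t) by push_cast; ring, Complex.exp_add,
      show I * (x - t) * y = I * x * y + (-I * y * t) by ring, Complex.exp_add, ofReal_exp]
    ring
  rw [intervalIntegral.integral_of_le hL.le]
  simp_rw [← hr]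
  rw [← hsw]
  have hli := hint.integral_prod_left
  have := integral_re (𝕜 := ℂ) hli
  simp only [RCLike.re_eq_complex_re, Function.uncurry_apply_pair] at this
  rw [← this]
  congr 1
  ext t
  rw [hl, ← ofReal_mul, re_ofReal_mul]
  have := hre (x - t)
  push_cast at this
  rw [this]

lemma taub_eq {φ : ℝ → ℝ} (hm : Measurable φ) {C : ℝ} (hC : ∀ t, |φ t| ≤ C)
    {H : ℂ → ℂ} (hHc : ContinuousOn H {s | 0 ≤ s.re})
    (hH : ∀ s : ℂ, 0 < s.re → ∫ t in Set.Ioi (0:ℝ), (φ t : ℂ) * cexp (-s * t) = H s)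
    {L : ℝ} (hL : 0 < L) (x : ℝ) :
    ∫ t in Set.Ioi (0:ℝ), φ t * (L * fejK (L * (x - t))) =
      (∫ y in (0:ℝ)..L, (2 * (1 - y / L) : ℂ) * cexp (I * x * y) * H (I * y)).re := by
  have hC0 : 0 ≤ C := (abs_nonneg _).trans (hC 0)
  have hK : Integrable (fun t : ℝ => L * fejK (L * (x - t))) := by
    have := (fejK_integrable.comp_mul_left' hL.ne').comp_sub_left x
    exact this.const_mul L
  have h1 : Tendsto (fun ε : ℝ => ∫ t in Set.Ioi (0:ℝ), φ t * Real.exp (-ε * t) * (L * fejK (L * (x - t))))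
      (nhdsWithin 0 (Set.Ioi 0)) (nhds (∫ t in Set.Ioi (0:ℝ), φ t * (L * fejK (L * (x - t))))) := by
    refine tendsto_integral_filter_of_dominated_convergence
      (fun t => C * (L * fejK (L * (x - t)))) ?_ ?_ ?_ ?_
    · refine .of_forall fun ε => ?_
      apply Measurable.aestronglyMeasurable
      have := fejK_cont.measurable
      fun_prop
    · filter_upwards [self_mem_nhdsWithin] with ε hε
      filter_upwards [ae_restrict_mem measurableSet_Ioi] with t ht
      simp only [Set.mem_Ioi] at ht hε
      have k0 : 0 ≤ L * fejK (L * (x - t)) := mul_nonneg hL.le (fejK_nonneg _)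
      rw [norm_mul, norm_mul, Real.norm_eq_abs, Real.norm_eq_abs, Real.norm_eq_abs, abs_of_nonneg k0,
        abs_of_pos (Real.exp_pos _)]
      have : Real.exp (-ε * t) ≤ 1 := by rw [Real.exp_le_one_iff]; nlinarith
      calc |φ t| * Real.exp (-ε * t) * _ ≤ C * 1 * (L * fejK (L * (x - t))) := by
            have := hC t; gcongr
        _ = _ := by ring
    · exact (hK.const_mul C).integrableOn
    · refine .of_forall fun t => ?_
      have : Continuous fun ε : ℝ => φ t * Real.exp (-ε * t) * (L * fejK (L * (x - t))) := by fun_prop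
      have := this.tendsto 0
      simp only [neg_zero, zero_mul, Real.exp_zero, mul_one] at this
      exact this.mono_left nhdsWithin_le_nhds
  obtain ⟨B, hB⟩ : ∃ B, ∀ s ∈ Set.Icc (0:ℝ) 1 ×ℂ Set.Icc 0 L, ‖H s‖ ≤ B := by
    refine IsCompact.exists_bound_of_continuousOn (isCompact_Icc.reProdIm isCompact_Icc) (hHc.mono ?_)
    intro s hs
    exact hs.1.1
  have hline : ∀ ε : ℝ, 0 ≤ ε → Continuous fun y : ℝ => H (ε + I * y) := by
    intro ε hε
    refine hHc.comp_continuous (by fun_prop) (fun y => ?_)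
    simpa using hε
  have h2 : Tendsto (fun ε : ℝ => ∫ y in (0:ℝ)..L, (2 * (1 - y / L) : ℂ) * cexp (I * x * y) * H (ε + I * y))
      (nhdsWithin 0 (Set.Ioi 0))
      (nhds (∫ y in (0:ℝ)..L, (2 * (1 - y / L) : ℂ) * cexp (I * x * y) * H (I * y))) := by
    refine intervalIntegral.tendsto_integral_filter_of_dominated_convergence (fun _ => 2 * B) ?_ ?_ ?_ ?_
    · filter_upwards [self_mem_nhdsWithin] with ε hε
      have := hline ε (le_of_lt hε)
      apply Continuous.aestronglyMeasurable
      exact Continuous.mul (by fun_prop) this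
    · have : ∀ᶠ ε : ℝ in nhdsWithin 0 (Set.Ioi 0), ε ∈ Set.Ioc (0:ℝ) 1 := Ioc_mem_nhdsGT one_pos
      filter_upwards [this] with ε hε
      refine .of_forall fun y hy => ?_
      rw [Set.uIoc_of_le hL.le] at hy
      have e1 : ‖cexp (I * x * y)‖ = 1 := by
        rw [show I * x * y = ((x * y : ℝ) : ℂ) * I by push_cast; ring,
          norm_exp_ofReal_mul_I]
      have e2 : ‖(2 * (1 - y / L) : ℂ)‖ ≤ 2 := by
        rw [show (2 * (1 - y / L) : ℂ) = ((2 * (1 - y / L) : ℝ) : ℂ) by push_cast; ring, norm_real,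
          Real.norm_eq_abs, abs_le]
        have : y / L ≤ 1 := by rw [div_le_one hL]; exact hy.2
        have : 0 ≤ y / L := by have := hy.1.le; positivity
        constructor <;> linarith
      rw [norm_mul, norm_mul, e1, mul_one]
      have := hB (ε + I * y) ⟨by simpa using ⟨hε.1.le, hε.2⟩, by simpa using ⟨hy.1.le, hy.2⟩⟩
      gcongr
    · simp
    · refine .of_forall fun y _ => ?_
      have hc : ContinuousWithinAt (fun ε : ℝ => H (ε + I * y)) (Set.Ioi 0) 0 := by
        have := hHc ((0:ℝ) + I * y) (by simp)
        refine ContinuousWithinAt.comp (t := {s : ℂ | 0 ≤ s.re}) this (by fun_prop) ?_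
        intro ε hε
        simpa using le_of_lt hε
      have := hc.tendsto
      simp only [ofReal_zero, zero_add] at this
      exact this.const_mul _
  have h3 := (continuous_re.tendsto _).comp h2
  refine tendsto_nhds_unique_of_eventuallyEq h1 h3 ?_
  filter_upwards [self_mem_nhdsWithin] with ε hε
  exact taub_swap hm hC hH hL hε x

lemma taub_lim {φ : ℝ → ℝ} (hm : Measurable φ) {C : ℝ} (hC : ∀ t, |φ t| ≤ C)
    {H : ℂ → ℂ} (hHc : ContinuousOn H {s | 0 ≤ s.re})
    (hH : ∀ s : ℂ, 0 < s.re → ∫ t in Set.Ioi (0:ℝ), (φ t : ℂ) * cexp (-s * t) = H s)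
    {L : ℝ} (hL : 0 < L) :
    Tendsto (fun x => ∫ t in Set.Ioi (0:ℝ), φ t * (L * fejK (L * (x - t)))) atTop (nhds 0) := by
  simp_rw [taub_eq hm hC hHc hH hL]
  set h : ℝ → ℂ := (Set.Ioc 0 L).indicator (fun y => (2 * (1 - y / L) : ℂ) * H (I * y)) with hh
  have := Real.tendsto_integral_exp_smul_cocompact h
  have h2 : Tendsto (fun x : ℝ => -x / (2 * π)) atTop (cocompact ℝ) := by
    refine Tendsto.mono_right ?_ atBot_le_cocompact
    exact (tendsto_neg_atTop_atBot).atBot_div_const (by positivity)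
  have h3 := (continuous_re.tendsto _).comp (this.comp h2)
  simp only [zero_re] at h3
  refine h3.congr fun x => ?_
  simp only [Function.comp]
  congr 1
  rw [intervalIntegral.integral_of_le hL.le, ← integral_indicator measurableSet_Ioc]
  congr 1
  ext y
  by_cases hy : y ∈ Set.Ioc 0 L
  · simp only [hh, Set.indicator_of_mem hy, Circle.smul_def, Real.fourierChar_apply, smul_eq_mul]
    rw [show (↑(2 * π * -(y * (-x / (2 * π)))) : ℂ) * I = I * x * y by
      push_cast
      have : (π : ℂ) ≠ 0 := by exact_mod_cast Real.pi_ne_zero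
      field_simp]
    ring
  · simp [hh, Set.indicator_of_notMem hy]

end tauber

section tauber2
open MeasureTheory

/-- scaled kernel -/
noncomputable def fejL (L u : ℝ) : ℝ := L * fejK (L * u)

lemma fejL_nonneg {L : ℝ} (hL : 0 < L) (u : ℝ) : 0 ≤ fejL L u := mul_nonneg hL.le (fejK_nonneg _)

lemma fejL_cont (L : ℝ) : Continuous (fejL L) := by
  have := fejK_cont
  unfold fejL; fun_prop

lemma fejL_integrable {L : ℝ} (hL : 0 < L) : Integrable (fejL L) :=
  (fejK_integrable.comp_mul_left' hL.ne').const_mul L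

lemma fejL_integral {L : ℝ} (hL : 0 < L) : ∫ u, fejL L u = ∫ u, fejK u := by
  unfold fejL
  rw [integral_const_mul, Measure.integral_comp_mul_left fejK L, abs_of_pos (by positivity), smul_eq_mul]
  field_simp

lemma fejL_tail {L : ℝ} (hL : 0 < L) :
    Tendsto (fun x => ∫ t in Set.Ioi (0:ℝ), fejL L (x - t)) atTop (nhds (∫ u, fejK u)) := by
  have h := (aecover_Iio (μ := volume) (l := atTop) (b := fun x : ℝ => x) tendsto_id).integral_tendsto_of_countably_generated
    (fejL_integrable hL)
  rw [fejL_integral hL] at h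
  refine h.congr fun x => ?_
  rw [← integral_indicator measurableSet_Ioi, ← integral_indicator measurableSet_Iio,
    ← integral_sub_left_eq_self _ volume x]
  congr 1
  ext t
  by_cases ht : 0 < t
  · rw [Set.indicator_of_mem (show x - t ∈ Set.Iio x by simpa using ht), Set.indicator_of_mem (by simpa using ht)]
  · rw [Set.indicator_of_notMem (show x - t ∉ Set.Iio x by simpa using ht), Set.indicator_of_notMem (by simpa using ht)]

lemma fejL_window {L δ : ℝ} (hL : 0 < L) (hδ : 0 < δ) (a : ℝ) :
    ∫ t in Set.Ioc (a - δ) (a + δ), fejL L (a - t) = ∫ u in (-(L * δ))..(L * δ), fejK u := by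
  rw [← intervalIntegral.integral_of_le (by linarith), intervalIntegral.integral_comp_sub_left (fejL L) a]
  unfold fejL
  rw [intervalIntegral.integral_const_mul, intervalIntegral.integral_comp_mul_left fejK hL.ne', smul_eq_mul,
    ← mul_assoc, mul_inv_cancel₀ hL.ne', one_mul]
  congr 1 <;> ring

lemma taub_main {g : ℝ → ℝ} (hm : Measurable g) {C : ℝ} (hC : ∀ t, g t ≤ C) (h0 : ∀ t, 0 ≤ g t)
    (hmono : Monotone fun t => g t * Real.exp t)
    {H : ℂ → ℂ} (hHc : ContinuousOn H {s | 0 ≤ s.re})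
    (hH : ∀ s : ℂ, 0 < s.re →
      ∫ t in Set.Ioi (0:ℝ), ((g t - 1 : ℝ) : ℂ) * Complex.exp (-s * t) = H s) :
    Tendsto g atTop (nhds 1) := by
  have hC0 : 0 ≤ C := (h0 0).trans (hC 0)
  set c := ∫ u, fejK u with hc
  have cpos : 0 < c := fejK_integral_pos
  have hkx : ∀ {L : ℝ}, 0 < L → ∀ x, Integrable fun t => fejL L (x - t) :=
    fun hL x => (fejL_integrable hL).comp_sub_left x
  have hgk : ∀ {L : ℝ}, 0 < L → ∀ x, Integrable fun t => g t * fejL L (x - t) := by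
    intro L hL x
    refine ((hkx hL x).const_mul C).mono' ?_ (.of_forall fun t => ?_)
    · apply Measurable.aestronglyMeasurable
      have := (fejL_cont L).measurable
      fun_prop
    · rw [norm_of_nonneg (mul_nonneg (h0 t) (fejL_nonneg hL _))]
      exact mul_le_mul_of_nonneg_right (hC t) (fejL_nonneg hL _)
  have hlim : ∀ {L : ℝ}, 0 < L →
      Tendsto (fun x => ∫ t in Set.Ioi (0:ℝ), g t * fejL L (x - t)) atTop (nhds c) := by
    intro L hL
    have h1 := taub_lim (φ := fun t => g t - 1) (C := C + 1) (by fun_prop)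
      (fun t => by rw [abs_le]; constructor <;> linarith [hC t, h0 t]) hHc hH hL
    have h2 := h1.add (fejL_tail hL)
    rw [zero_add] at h2
    refine h2.congr fun x => ?_
    have e : ∀ t, (g t - 1) * (L * fejK (L * (x - t))) = g t * fejL L (x - t) - fejL L (x - t) := by
      intro t; unfold fejL; ring
    simp_rw [e]
    rw [integral_sub (hgk hL x).integrableOn (hkx hL x).integrableOn]
    ring
  -- monotonicity
  have hmon : ∀ {s t d : ℝ}, s ≤ t → t ≤ s + d → g s * Real.exp (-d) ≤ g t := by
    intro s t d h1 h2
    have := hmono h1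
    simp only at this
    have e1 : g s * Real.exp (s - t) ≤ g t := by
      rw [Real.exp_sub, ← mul_div_assoc, div_le_iff₀ (Real.exp_pos _)]; exact this
    refine le_trans ?_ e1
    have := h0 s
    gcongr
    linarith
  set m : ℝ → ℝ := fun δ => ∫ u in (-(δ⁻¹))..(δ⁻¹), fejK u with hmdef
  have hm_lim : Tendsto m (nhdsWithin 0 (Set.Ioi 0)) (nhds c) := by
    have hinv : Tendsto (fun δ : ℝ => δ⁻¹) (nhdsWithin 0 (Set.Ioi 0)) atTop := tendsto_inv_nhdsGT_zero
    exact intervalIntegral_tendsto_integral fejK_integrable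
      (tendsto_neg_atTop_atBot.comp hinv) hinv
  have hup : ∀ δ > 0, 0 < m δ → ∀ᶠ x in atTop, g x ≤ (c + δ) * Real.exp (2 * δ) / m δ := by
    intro δ hδ hmpos
    have hL : 0 < δ⁻¹ ^ 2 := by positivity
    have hLδ : δ⁻¹ ^ 2 * δ = δ⁻¹ := by field_simp
    have h1 : Tendsto (fun x => ∫ t in Set.Ioi (0:ℝ), g t * fejL (δ⁻¹ ^ 2) (x + δ - t)) atTop (nhds c) :=
      (hlim hL).comp (tendsto_atTop_add_const_right _ δ tendsto_id)
    filter_upwards [h1.eventually (gt_mem_nhds (show c < c + δ by linarith)), eventually_ge_atTop 0] with x hx hx0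
    rw [le_div_iff₀ hmpos]
    have h2 : ∫ t in Set.Ioc (x + δ - δ) (x + δ + δ), g x * Real.exp (-(2 * δ)) * fejL (δ⁻¹ ^ 2) (x + δ - t)
        ≤ ∫ t in Set.Ioi (0:ℝ), g t * fejL (δ⁻¹ ^ 2) (x + δ - t) := by
      refine le_trans (setIntegral_mono_on ((hkx hL _).const_mul _).integrableOn (hgk hL _).integrableOn
        measurableSet_Ioc ?_) (setIntegral_mono_set (hgk hL _).integrableOn ?_ ?_)
      · intro t ht
        refine mul_le_mul_of_nonneg_right (hmon ?_ ?_) (fejL_nonneg hL _)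
        · linarith [ht.1]
        · linarith [ht.2]
      · exact .of_forall fun t => mul_nonneg (h0 t) (fejL_nonneg hL _)
      · refine LE.le.eventuallyLE fun t ht => ?_
        simp only [Set.mem_Ioi]
        linarith [ht.1]
    rw [integral_const_mul, fejL_window hL hδ, hLδ] at h2
    have h3 : g x * Real.exp (-(2 * δ)) * m δ ≤ c + δ := h2.trans hx.le
    rw [Real.exp_neg] at h3
    have := Real.exp_pos (2 * δ)
    field_simp at h3
    linarith
  have hlow : ∀ δ > 0, 0 < m δ → ∀ᶠ x in atTop, ((c - δ - C * c) / m δ + C) * Real.exp (-(2 * δ)) ≤ g x := by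
    intro δ hδ hmpos
    have hL : 0 < δ⁻¹ ^ 2 := by positivity
    have hLδ : δ⁻¹ ^ 2 * δ = δ⁻¹ := by field_simp
    have h1 : Tendsto (fun x => ∫ t in Set.Ioi (0:ℝ), g t * fejL (δ⁻¹ ^ 2) (x - δ - t)) atTop (nhds c) :=
      (hlim hL).comp (tendsto_atTop_add_const_right _ (-δ) tendsto_id)
    filter_upwards [h1.eventually (lt_mem_nhds (show c - δ < c by linarith))] with x hx
    have hind : Integrable ((Set.Ioc (x - δ - δ) (x - δ + δ)).indicator fun t => 
        (g x * Real.exp (2 * δ) - C) * fejL (δ⁻¹ ^ 2) (x - δ - t)) :=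
      ((hkx hL _).const_mul _).indicator measurableSet_Ioc
    have h2 : ∫ t in Set.Ioi (0:ℝ), g t * fejL (δ⁻¹ ^ 2) (x - δ - t) ≤
        ∫ t, (C * fejL (δ⁻¹ ^ 2) (x - δ - t) + (Set.Ioc (x - δ - δ) (x - δ + δ)).indicator (fun t => 
        (g x * Real.exp (2 * δ) - C) * fejL (δ⁻¹ ^ 2) (x - δ - t)) t) := by
      refine le_trans (setIntegral_le_integral (hgk hL _) 
        (.of_forall fun t => mul_nonneg (h0 t) (fejL_nonneg hL _))) ?_
      refine integral_mono (hgk hL _) (((hkx hL _).const_mul _).add hind) fun t => ?_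
      simp only
      have kn := fejL_nonneg hL (x - δ - t)
      by_cases ht : t ∈ Set.Ioc (x - δ - δ) (x - δ + δ)
      · rw [Set.indicator_of_mem ht]
        have := hmon (s := t) (t := x) (d := 2 * δ) (by linarith [ht.2]) (by linarith [ht.1])
        have h4 : g t ≤ g x * Real.exp (2 * δ) := by
          rwa [Real.exp_neg, ← div_eq_mul_inv, div_le_iff₀ (Real.exp_pos _)] at this
        nlinarith
      · rw [Set.indicator_of_notMem ht, add_zero]
        exact mul_le_mul_of_nonneg_right (hC t) kn
    rw [integral_add ((hkx hL _).const_mul _) hind, integral_indicator measurableSet_Ioc, integral_const_mul,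
      integral_const_mul, fejL_window hL hδ, hLδ, integral_sub_left_eq_self (fejL _) volume, fejL_integral hL] at h2
    have h3 : c - δ ≤ C * c + (g x * Real.exp (2 * δ) - C) * m δ := hx.le.trans h2
    have h5 : (c - δ - C * c) / m δ + C ≤ g x * Real.exp (2 * δ) := by
      rw [← le_sub_iff_add_le, div_le_iff₀ hmpos]; linarith
    rw [Real.exp_neg, ← div_eq_mul_inv, div_le_iff₀ (Real.exp_pos _)]
    exact h5
  have hid : Tendsto (fun δ : ℝ => δ) (nhdsWithin 0 (Set.Ioi 0)) (nhds 0) :=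
    tendsto_id.mono_left nhdsWithin_le_nhds
  have hexp : Tendsto (fun δ : ℝ => Real.exp (2 * δ)) (nhdsWithin 0 (Set.Ioi 0)) (nhds 1) := by
    have : Continuous fun δ : ℝ => Real.exp (2 * δ) := by fun_prop
    have := this.tendsto 0
    simp only [mul_zero, Real.exp_zero] at this
    exact this.mono_left nhdsWithin_le_nhds
  have hexp' : Tendsto (fun δ : ℝ => Real.exp (-(2 * δ))) (nhdsWithin 0 (Set.Ioi 0)) (nhds 1) := by
    have : Continuous fun δ : ℝ => Real.exp (-(2 * δ)) := by fun_prop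
    have := this.tendsto 0
    simp only [mul_zero, neg_zero, Real.exp_zero] at this
    exact this.mono_left nhdsWithin_le_nhds
  have hU : Tendsto (fun δ => (c + δ) * Real.exp (2 * δ) / m δ) (nhdsWithin 0 (Set.Ioi 0)) (nhds 1) := by
    have := ((hid.const_add c).mul hexp).div hm_lim cpos.ne'
    rwa [add_zero, mul_one, div_self cpos.ne'] at this
  have hLo : Tendsto (fun δ => ((c - δ - C * c) / m δ + C) * Real.exp (-(2 * δ)))
      (nhdsWithin 0 (Set.Ioi 0)) (nhds 1) := by
    have := (((((hid.const_sub c).sub_const (C * c)).div hm_lim cpos.ne')).add_const C).mul hexp'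
    rwa [show ((c - 0 - C * c) / c + C) * 1 = 1 by field_simp; ring] at this
  have hmp : ∀ᶠ δ in nhdsWithin 0 (Set.Ioi 0), 0 < m δ := hm_lim.eventually (lt_mem_nhds cpos)
  have hdp : ∀ᶠ δ : ℝ in nhdsWithin 0 (Set.Ioi 0), 0 < δ := self_mem_nhdsWithin
  rw [tendsto_order]
  constructor
  · intro a ha
    obtain ⟨δ, h1, h2, h3⟩ := ((hLo.eventually (lt_mem_nhds ha)).and (hmp.and hdp)).exists
    filter_upwards [hlow δ h3 h2] with x hx
    exact h1.trans_le hx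
  · intro a ha
    obtain ⟨δ, h1, h2, h3⟩ := ((hU.eventually (gt_mem_nhds ha)).and (hmp.and hdp)).exists
    filter_upwards [hup δ h3 h2] with x hx
    exact hx.trans_lt h1

end tauber2

section pnt
open MeasureTheory Chebyshev

lemma vonM_laplace {s : ℂ} (hs : 0 < s.re) :
    ∫ t in Set.Ioi (0:ℝ), ((psi (Real.exp t) * Real.exp (-t) : ℝ) : ℂ) * Complex.exp (-s * t) =
      LSeries (fun n => (ArithmeticFunction.vonMangoldt n : ℂ)) (s + 1) / (s + 1) := by
  have hs1 : (s + 1) ≠ 0 := by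
    intro h
    have := congrArg Complex.re h
    simp at this; linarith
  have hO : (fun n : ℕ ↦ ∑ k ∈ Finset.Icc 1 n, ArithmeticFunction.vonMangoldt k)
      =O[atTop] fun n ↦ (n : ℝ) ^ (1:ℝ) := by
    refine Asymptotics.IsBigO.of_bound (Real.log 4 + 4) (.of_forall fun n => ?_)
    have h1 := psi_le_const_mul_self (x := n) (by positivity)
    have h2 := psi_nonneg n
    have h3 : psi n = ∑ k ∈ Finset.Icc 1 n, ArithmeticFunction.vonMangoldt k := by
      rw [psi, Nat.floor_natCast]; rfl
    rw [← h3, Real.rpow_one, norm_of_nonneg h2, norm_of_nonneg (by positivity)]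
    exact h1
  have h := LSeries_eq_mul_integral_of_nonneg (fun n => ArithmeticFunction.vonMangoldt n) zero_le_one
    (s := s + 1) (by simpa using hs) hO (fun n => ArithmeticFunction.vonMangoldt_nonneg)
  rw [h, mul_div_cancel_left₀ _ hs1]
  have himg : Real.exp '' Set.Ioi 0 = Set.Ioi 1 := by
    ext y
    constructor
    · rintro ⟨t, ht, rfl⟩
      simpa using ht
    · intro hy
      exact ⟨Real.log y, Real.log_pos hy, Real.exp_log (lt_trans zero_lt_one hy)⟩
  rw [← himg, integral_image_eq_integral_abs_deriv_smul measurableSet_Ioi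
    (fun t _ => (Real.hasDerivAt_exp t).hasDerivWithinAt) Real.exp_injective.injOn]
  refine setIntegral_congr_fun measurableSet_Ioi fun t _ => ?_
  simp only [abs_of_pos (Real.exp_pos t), Complex.real_smul]
  have e1 : ∑ k ∈ Finset.Icc 1 ⌊Real.exp t⌋₊, (ArithmeticFunction.vonMangoldt k : ℂ) = (psi (Real.exp t) : ℂ) := by
    rw [psi]; push_cast; rfl
  rw [e1, Complex.cpow_def_of_ne_zero (by exact_mod_cast (Real.exp_pos t).ne'), ← Complex.ofReal_log (Real.exp_pos t).le,
    Real.log_exp]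
  push_cast
  have e2 : Complex.exp (t * -(s + 1 + 1)) = Complex.exp (-t) * Complex.exp (-t) * Complex.exp (-s * t) := by
    rw [← Complex.exp_add, ← Complex.exp_add]; congr 1; ring
  rw [e2]
  have e3 : Complex.exp t * Complex.exp (-t) = 1 := by rw [← Complex.exp_add]; simp
  linear_combination (-(psi (Real.exp t) : ℂ) * Complex.exp (-t) * Complex.exp (-s * t)) * e3

lemma exists_ext : ∃ A : ℂ → ℂ, ContinuousOn A {s | 1 ≤ s.re} ∧ ∀ s : ℂ, 1 < s.re →
    LSeries (fun n => (ArithmeticFunction.vonMangoldt n : ℂ)) s = A s + 1 / (s - 1) := by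
  refine ⟨ArithmeticFunction.vonMangoldt.LFunctionResidueClassAux (q := 1) 1,
    ArithmeticFunction.vonMangoldt.continuousOn_LFunctionResidueClassAux _, fun s hs => ?_⟩
  have := ArithmeticFunction.vonMangoldt.eqOn_LFunctionResidueClassAux (q := 1) (a := 1) isUnit_one hs
  rw [this]
  have e : ∀ n : ℕ, ArithmeticFunction.vonMangoldt.residueClass (1 : ZMod 1) n = ArithmeticFunction.vonMangoldt n := by
    intro n
    unfold ArithmeticFunction.vonMangoldt.residueClass
    rw [Set.indicator_of_mem]
    exact Subsingleton.elim _ _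
  simp [e]

lemma psi_exp_tendsto : Tendsto (fun t => psi (Real.exp t) * Real.exp (-t)) atTop (nhds 1) := by
  obtain ⟨A, hA, hAL⟩ := exists_ext
  have hbd : ∀ t : ℝ, psi (Real.exp t) * Real.exp (-t) ≤ Real.log 4 + 4 := by
    intro t
    rw [Real.exp_neg, ← div_eq_mul_inv, div_le_iff₀ (Real.exp_pos _)]
    exact psi_le_const_mul_self (Real.exp_pos _).le
  have hnn : ∀ t : ℝ, 0 ≤ psi (Real.exp t) * Real.exp (-t) :=
    fun t => mul_nonneg (psi_nonneg _) (Real.exp_pos _).le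
  have hms : Measurable fun t => psi (Real.exp t) * Real.exp (-t) := by
    have := psi_mono.measurable
    fun_prop
  refine taub_main (H := fun s => (A (s + 1) - 1) / (s + 1)) hms hbd hnn ?_ ?_ ?_
  · intro a b hab
    have : ∀ t : ℝ, psi (Real.exp t) * Real.exp (-t) * Real.exp t = psi (Real.exp t) := by
      intro t; rw [mul_assoc, ← Real.exp_add]; simp
    simp only [this]
    exact psi_mono (Real.exp_le_exp.2 hab)
  · refine ContinuousOn.div ((hA.comp (by fun_prop) ?_).sub continuousOn_const) (by fun_prop) ?_
    · intro s hs; simpa using hs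
    · intro s hs h
      have := congrArg Complex.re h
      simp at this hs; linarith
  · intro s hs
    have hs0 : s ≠ 0 := by rintro rfl; simp at hs
    have hs1 : (s + 1) ≠ 0 := by
      intro h
      have := congrArg Complex.re h
      simp at this; linarith
    have hi : IntegrableOn (fun t : ℝ => Complex.exp (-s * t)) (Set.Ioi 0) :=
      integrableOn_exp_mul_complex_Ioi (by simpa using hs) 0
    have e1 : ∫ t in Set.Ioi (0:ℝ), Complex.exp (-s * t) = 1 / s := by
      rw [integral_exp_mul_complex_Ioi (by simpa using hs) 0]
      simp
    have hi2 : IntegrableOn (fun t : ℝ => ((psi (Real.exp t) * Real.exp (-t) : ℝ) : ℂ) * Complex.exp (-s * t)) (Set.Ioi 0) := by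
      refine hi.bdd_mul (c := Real.log 4 + 4) ?_ ?_
      · exact (Complex.measurable_ofReal.comp hms).aestronglyMeasurable
      · refine .of_forall fun t => ?_
        rw [Complex.norm_real, norm_of_nonneg (hnn t)]
        exact hbd t
    have := integral_sub hi2 hi
    rw [e1, vonM_laplace hs, hAL (s + 1) (by simpa using hs)] at this
    have h2 : (A (s + 1) + 1 / (s + 1 - 1)) / (s + 1) - 1 / s = (A (s + 1) - 1) / (s + 1) := by
      rw [add_sub_cancel_right]; field_simp; ring
    rw [← h2, ← this]
    congr 1
    ext t
    push_cast
    ring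

lemma psi_pnt : Tendsto (fun x => psi x / x) atTop (nhds 1) := by
  refine (psi_exp_tendsto.comp Real.tendsto_log_atTop).congr' ?_
  filter_upwards [eventually_gt_atTop 0] with x hx
  simp [Real.exp_neg, Real.exp_log hx, div_eq_mul_inv]

lemma theta_pnt : Tendsto (fun x => theta x / x) atTop (nhds 1) := by
  have h1 : Tendsto (fun x => (psi x - theta x) / x) atTop (nhds 0) := by
    have h2 : (psi - theta) =o[atTop] (fun x : ℝ => x) := by
      refine isBigO_psi_sub_theta_sqrt.trans_isLittleO ?_
      refine Asymptotics.isLittleO_of_tendsto' ?_ ?_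
      · filter_upwards [eventually_gt_atTop 0] with x hx h0
        exact absurd h0 hx.ne'
      · simp_rw [Real.sqrt_div_self]
        exact Real.tendsto_sqrt_atTop.inv_tendsto_atTop
    exact h2.tendsto_div_nhds_zero
  have := psi_pnt.sub h1
  rw [sub_zero] at this
  refine this.congr fun x => ?_
  ring

lemma pi_pnt : Tendsto (fun x : ℝ => (Nat.primeCounting ⌊x⌋₊ : ℝ) * Real.log x / x) atTop (nhds 1) := by
  have h := integral_theta_div_log_sq_isLittleO.tendsto_div_nhds_zero
  have := theta_pnt.add h
  rw [add_zero] at this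
  refine this.congr' ?_
  filter_upwards [eventually_ge_atTop 2] with x hx
  rw [primeCounting_eq_theta_div_log_add_integral hx]
  have : 0 < Real.log x := Real.log_pos (by linarith)
  field_simp

end pnt

section final
open MeasureTheory

lemma p_ge {n : ℕ} (hn : 1 ≤ n) : n + 1 ≤ p n := by
  have := Nat.add_two_le_nth_prime (n - 1)
  unfold p; omega

lemma p_mono : Monotone p := by
  intro a b hab
  unfold p
  exact Nat.nth_monotone Nat.infinite_setOfPred_prime (by omega)

lemma p_count {n : ℕ} (hn : 1 ≤ n) : Nat.primeCounting (p n) = n := by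
  unfold p Nat.primeCounting Nat.primeCounting'
  rw [Nat.count_nth_succ_of_infinite Nat.infinite_setOfPred_prime]
  omega

lemma p_tendsto : Tendsto (fun n => (p n : ℝ)) atTop atTop := by
  refine tendsto_atTop_mono' _ ?_ tendsto_natCast_atTop_atTop
  filter_upwards [eventually_ge_atTop 1] with n hn
  exact_mod_cast (by have := p_ge hn; omega : n ≤ p n)

lemma p_asymp : Tendsto (fun n : ℕ => (p n : ℝ) / (n * Real.log n)) atTop (nhds 1) := by
  have h1 : Tendsto (fun n : ℕ => (n : ℝ) * Real.log (p n) / p n) atTop (nhds 1) := by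
    refine (pi_pnt.comp p_tendsto).congr' ?_
    filter_upwards [eventually_ge_atTop 1] with n hn
    simp [Nat.floor_natCast, p_count hn]
  have hlp : Tendsto (fun n => Real.log (p n)) atTop atTop := Real.tendsto_log_atTop.comp p_tendsto
  have h2 : Tendsto (fun n : ℕ => Real.log n / Real.log (p n)) atTop (nhds 1) := by
    have a1 := (h1.log one_ne_zero).mul (hlp.inv_tendsto_atTop)
    have a2 : Tendsto (fun n => Real.log (Real.log (p n)) / Real.log (p n)) atTop (nhds 0) :=
      (Real.isLittleO_log_id_atTop.tendsto_div_nhds_zero).comp hlp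
    have a3 := (a1.sub a2).add_const 1
    simp only [Real.log_one, zero_mul, sub_zero, zero_add] at a3
    refine a3.congr' ?_
    filter_upwards [eventually_ge_atTop 1, hlp.eventually_gt_atTop 0, p_tendsto.eventually_gt_atTop 0] with n hn hl hp
    have hn' : (n : ℝ) ≠ 0 := by positivity
    simp only [Pi.inv_apply]
    rw [Real.log_div (by positivity) hp.ne', Real.log_mul hn' hl.ne']
    field_simp
    ring
  have h3 := (h1.mul h2).inv₀ (by norm_num)
  simp only [mul_one, inv_one] at h3
  refine h3.congr' ?_
  filter_upwards [eventually_gt_atTop 1, hlp.eventually_gt_atTop 0, p_tendsto.eventually_gt_atTop 0] with n hn hl hp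
  have : 0 < Real.log n := Real.log_pos (by exact_mod_cast hn)
  have hn' : (0:ℝ) < n := by positivity
  field_simp

lemma ratio_lim {α β : ℝ} (hα : 0 ≤ α) (hβ : 0 ≤ β) (hne : ¬(α = 0 ∧ β = 0))
    {m : ℕ → ℕ} {t : ℝ} (ht : 0 < t) (hm : Tendsto (fun n : ℕ => (m n : ℝ) / n) atTop (nhds t)) :
    Tendsto (fun n : ℕ => (α * (p (m n) : ℝ) + β * (m n : ℝ)) / (α * (p n : ℝ) + β * (n : ℝ)))
      atTop (nhds t) := by
  rcases hα.eq_or_lt with rfl | hα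
  · have hβ : β ≠ 0 := by simpa using hne
    refine hm.congr fun n => ?_
    simp only [zero_mul, zero_add]
    rw [mul_div_mul_left _ _ hβ]
  have hlog : Tendsto (fun n : ℕ => Real.log n) atTop atTop :=
    Real.tendsto_log_atTop.comp tendsto_natCast_atTop_atTop
  set a : ℕ → ℝ := fun n => α * (p n : ℝ) + β * (n : ℝ) with ha
  have h1 : Tendsto (fun n : ℕ => a n / (n * Real.log n)) atTop (nhds α) := by
    have := (p_asymp.const_mul α).add (hlog.inv_tendsto_atTop.const_mul β)
    simp only [mul_one, mul_zero, add_zero] at this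
    refine this.congr' ?_
    filter_upwards [eventually_gt_atTop 1] with n hn
    have : 0 < Real.log n := Real.log_pos (by exact_mod_cast hn)
    have hn' : (0:ℝ) < n := by positivity
    simp only [ha, Pi.inv_apply]
    field_simp
  have hmR : Tendsto (fun n => (m n : ℝ)) atTop atTop := by
    have := hm.pos_mul_atTop ht tendsto_natCast_atTop_atTop
    refine this.congr' ?_
    filter_upwards [eventually_ge_atTop 1] with n hn
    have hn' : (0:ℝ) < n := by positivity
    field_simp
  have hmN : Tendsto m atTop atTop := tendsto_natCast_atTop_iff.1 hmR
  have h2 : Tendsto (fun n : ℕ => Real.log (m n) / Real.log n) atTop (nhds 1) := by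
    have := ((hm.log ht.ne').mul hlog.inv_tendsto_atTop).add_const 1
    rw [mul_zero, zero_add] at this
    refine this.congr' ?_
    filter_upwards [eventually_gt_atTop 1, hmR.eventually_gt_atTop 0] with n hn hmn
    have : 0 < Real.log n := Real.log_pos (by exact_mod_cast hn)
    have hn' : (0:ℝ) < n := by positivity
    simp only [Pi.inv_apply]
    rw [Real.log_div hmn.ne' hn'.ne']
    field_simp
    ring
  have h3 := (((h1.comp hmN).div h1 hα.ne').mul hm).mul h2
  rw [div_self hα.ne', one_mul, mul_one] at h3
  refine h3.congr' ?_
  filter_upwards [eventually_gt_atTop 1, hmR.eventually_gt_atTop 1] with n hn hmn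
  have : 0 < Real.log n := Real.log_pos (by exact_mod_cast hn)
  have : 0 < Real.log (m n) := Real.log_pos hmn
  have hn' : (0:ℝ) < n := by positivity
  have hm' : (0:ℝ) < m n := by linarith
  have han : 0 < a n := by
    have : (0:ℝ) < p n := by exact_mod_cast (by have := p_ge hn.le; omega : 0 < p n)
    simp only [ha]; positivity
  simp only [Pi.div_apply, Function.comp_apply]
  change _ = a (m n) / a n
  field_simp

lemma sum_eq_int (G : ℕ → ℝ) {n : ℕ} (hn : 1 ≤ n) :
    (1 / (n : ℝ)) * ∑ r ∈ Finset.Icc 1 n, G r = ∫ u in (0:ℝ)..1, G ⌈u * n⌉₊ := by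
  have hn' : (n : ℝ) ≠ 0 := by positivity
  rw [intervalIntegral.integral_comp_mul_right (fun v => G ⌈v⌉₊) hn', smul_eq_mul, zero_mul, one_mul, one_div]
  congr 1
  have hc : ∀ k : ℕ, Set.EqOn (fun _ => G (k + 1)) (fun v : ℝ => G ⌈v⌉₊) (Set.uIoc (k:ℝ) ((k + 1 : ℕ) : ℝ)) := by
    intro k v hv
    rw [Set.uIoc_of_le (by push_cast; linarith)] at hv
    simp only
    congr 1
    symm
    rw [Nat.ceil_eq_iff (by omega)]
    simpa using hv
  have := intervalIntegral.sum_integral_adjacent_intervals (f := fun v : ℝ => G ⌈v⌉₊) (μ := volume)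
    (a := fun k : ℕ => (k : ℝ)) (n := n) (fun k _ =>
      (intervalIntegrable_const (c := G (k + 1))).congr (hc k))
  simp only [Nat.cast_zero] at this
  rw [← this, Finset.sum_bij (s := Finset.Icc 1 n) (t := Finset.range n) (fun r _ => r - 1)]
  · intro r hr; simp at hr ⊢; omega
  · intro r hr s hs h; simp at hr hs; omega
  · intro k hk; simp at hk; exact ⟨k + 1, by simp; omega, by simp⟩
  · intro r hr
    simp at hr
    rw [← intervalIntegral.integral_congr_ae (.of_forall fun v hv => hc (r - 1) hv), intervalIntegral.integral_const]
    rw [show r - 1 + 1 = r by omega]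
    have : ((r - 1 : ℕ) : ℝ) = r - 1 := by push_cast [hr.1]; rfl
    simp [this]

end final

theorem stmt_16
    (α β : ℝ) (hα : 0 ≤ α) (hβ : 0 ≤ β) (hne : ¬(α = 0 ∧ β = 0))
    (f : ℝ → ℝ) (hf : ContinuousOn f (Set.Icc 0 1)) :
    Tendsto
      (fun n : ℕ =>
        (1 / (n : ℝ)) *
          ∑ r ∈ Finset.Icc 1 n,
            f ((α * (p r : ℝ) + β * (r : ℝ)) / (α * (p n : ℝ) + β * (n : ℝ))))
      atTop (nhds (∫ x in (0:ℝ)..1, f x)) := by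
  obtain ⟨B, hB⟩ := isCompact_Icc.exists_bound_of_continuousOn hf
  have hmem : ∀ {r n : ℕ}, r ≤ n →
      (α * (p r : ℝ) + β * (r : ℝ)) / (α * (p n : ℝ) + β * (n : ℝ)) ∈ Set.Icc (0:ℝ) 1 := by
    intro r n hrn
    have h1 : (p r : ℝ) ≤ p n := by exact_mod_cast p_mono hrn
    have h2 : (r : ℝ) ≤ n := by exact_mod_cast hrn
    constructor
    · positivity
    · refine div_le_one_of_le₀ ?_ (by positivity)
      gcongr
  have hceil : ∀ {u : ℝ} {n : ℕ}, u ≤ 1 → ⌈u * n⌉₊ ≤ n := by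
    intro u n hu
    rw [Nat.ceil_le]
    exact mul_le_of_le_one_left (by positivity) hu
  have key : Tendsto (fun n : ℕ => ∫ u in (0:ℝ)..1,
      f ((α * (p ⌈u * n⌉₊ : ℝ) + β * (⌈u * n⌉₊ : ℝ)) / (α * (p n : ℝ) + β * (n : ℝ))))
      atTop (nhds (∫ x in (0:ℝ)..1, f x)) := by
    refine intervalIntegral.tendsto_integral_filter_of_dominated_convergence (fun _ => B) ?_ ?_ ?_ ?_
    · refine .of_forall fun n => ?_
      apply Measurable.aestronglyMeasurable
      have hg : Measurable fun r : ℕ =>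
        f ((α * (p r : ℝ) + β * (r : ℝ)) / (α * (p n : ℝ) + β * (n : ℝ))) := measurable_from_nat
      have hc : Measurable fun u : ℝ => ⌈u * n⌉₊ := Nat.measurable_ceil.comp (by fun_prop)
      exact hg.comp hc
    · refine .of_forall fun n => .of_forall fun u hu => ?_
      rw [Set.uIoc_of_le zero_le_one] at hu
      exact hB _ (hmem (hceil hu.2))
    · simp
    · refine .of_forall fun u hu => ?_
      rw [Set.uIoc_of_le zero_le_one] at hu
      have hm : Tendsto (fun n : ℕ => (⌈u * n⌉₊ : ℝ) / n) atTop (nhds u) :=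
        (tendsto_nat_ceil_mul_div_atTop hu.1.le).comp tendsto_natCast_atTop_atTop
      have h1 := ratio_lim hα hβ hne hu.1 hm
      refine (hf u ⟨hu.1.le, hu.2⟩).tendsto.comp (tendsto_nhdsWithin_iff.2 ⟨h1, .of_forall fun n => ?_⟩)
      exact hmem (hceil hu.2)
  refine key.congr' ?_
  filter_upwards [eventually_ge_atTop 1] with n hn
  exact (sum_eq_int (fun r => f ((α * (p r : ℝ) + β * (r : ℝ)) / (α * (p n : ℝ) + β * (n : ℝ)))) hn).symm
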